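/- Let p and q be odd primes with p ≡ −1 (mod q), and let A = ℤ/p × ℤ/p × ℤ/q. Then there is no regular subgroup G of Hol(A) such that the image π₂(G) has order pq. -/

import Mathlib

/-- The holomorph `Hol(A) = A ⋊ Aut(A)` of a group `A`. -/
abbrev Hol (A : Type*) [Group A] :=
  SemidirectProduct A (MulAut A) (MonoidHom.id (MulAut A))

/-- The natural action of an element `(a, f)` of `Hol(A)` on `A`: `(a, f) · x = a * f x`. -/
def holSmul {A : Type*} [Group A] (g : Hol A) (x : A) : A :=
  g.left * g.right x

/-- A subgroup `G ≤ Hol(A)` is regular if for all `x y : A` there is exactly one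
`g ∈ G` with `g · x = y`. -/
def IsRegularSubgroup {A : Type*} [Group A] (G : Subgroup (Hol A)) : Prop :=
  ∀ x y : A, ∃! g : G, holSmul (g : Hol A) x = y

/-- An automorphism `f` with `f ^ q = 1`, `q` prime, that stabilises a subgroup `H` of a finite
group fixes a number of elements of `H` congruent to the order of `H` modulo `q`. -/
theorem card_modEq_card_inf_eqLocus {A : Type*} [Group A] [Finite A] {q : ℕ} [Fact q.Prime]
    {f : MulAut A} (hf : f ^ q = 1) {H : Subgroup A} (hH : ∀ x ∈ H, f x ∈ H) :
    Nat.card H ≡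
      Nat.card (H ⊓ f.toMonoidHom.eqLocus (MonoidHom.id A) : Subgroup A) [MOD q] := by
  classical
  have := Fintype.ofFinite A
  let φ : Function.End H := fun x => ⟨f x, hH x x.2⟩
  have hpow : ∀ (n : ℕ) (x : H), (((φ ^ n) x : H) : A) = (f ^ n) x := by
    intro n
    induction n with
    | zero => exact fun _ => rfl
    | succ n ih =>
      intro x
      rw [pow_succ, pow_succ]
      exact ih (φ x)
  have hφ : φ ^ q ^ 1 = 1 := by
    funext x
    apply Subtype.ext
    rw [pow_one, hpow, hf]
    rfl
  have key := Equiv.Perm.card_fixedPoints_modEq hφ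
  rw [← Nat.card_eq_fintype_card, ← Nat.card_eq_fintype_card] at key
  have e : Function.fixedPoints φ ≃
      (H ⊓ f.toMonoidHom.eqLocus (MonoidHom.id A) : Subgroup A) :=
    { toFun := fun x => ⟨x.1, x.1.2, congrArg Subtype.val x.2⟩
      invFun := fun x => ⟨⟨x.1, x.2.1⟩, Subtype.ext x.2.2⟩
      left_inv := fun _ => rfl
      right_inv := fun _ => rfl }
  rwa [Nat.card_congr e] at key

/-- Let `A` be abelian of order `p²q`, where `p ≡ -1` modulo the odd prime `q`. An automorphism
`f` of `A` with `f ^ q = 1` that stabilises a subgroup of order `p` is trivial. -/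
theorem mulAut_eq_one_of_stabilises {A : Type*} [CommGroup A] [Finite A] {p q : ℕ}
    [hp : Fact p.Prime] [hq : Fact q.Prime] (hqodd : Odd q) (hmod : (p : ZMod q) = -1)
    (hA : Nat.card A = p ^ 2 * q) {f : MulAut A} (hf : f ^ q = 1) {K : Subgroup A}
    (hK : Nat.card K = p) (hfK : ∀ x ∈ K, f x ∈ K) : f = 1 := by
  set F := f.toMonoidHom.eqLocus (MonoidHom.id A)
  have hq2 : Fact (2 < q) :=
    ⟨lt_of_le_of_ne hq.out.two_le (by rintro rfl; exact absurd hqodd (by decide))⟩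
  have hone : (-1 : ZMod q) ≠ 1 := ZMod.neg_one_ne_one
  have hpq : p ≠ q := by
    rintro rfl
    rw [ZMod.natCast_self] at hmod
    simp [eq_comm] at hmod
  have hKF : K ≤ F := by
    have h := card_modEq_card_inf_eqLocus hf hfK
    have hdvd : Nat.card (K ⊓ F : Subgroup A) ∣ p :=
      hK ▸ Subgroup.card_dvd_of_le inf_le_left
    rw [hK, ← ZMod.natCast_eq_natCast_iff, hmod] at h
    rcases (Nat.dvd_prime hp.out).1 hdvd with h1 | h1
    · rw [h1, Nat.cast_one] at h
      exact absurd h hone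
    · exact inf_eq_left.1 (Subgroup.eq_of_le_of_card_ge inf_le_left (by rw [h1, hK]))
  obtain ⟨S, hKS⟩ := (IsPGroup.of_card (n := 1) (by rw [hK, pow_one]) :
    IsPGroup p K).exists_le_sylow
  have hS : Nat.card S = p ^ 2 := by
    rw [S.card_eq_multiplicity, hA, Nat.factorization_mul (pow_ne_zero _ hp.out.ne_zero)
      hq.out.ne_zero, hp.out.factorization_pow, hq.out.factorization]
    simp [hpq.symm]
  have hfS : ∀ x ∈ (S : Subgroup A), f x ∈ (S : Subgroup A) := by
    have hchar := S.characteristic_of_normal inferInstance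
    intro x hx
    rw [← Subgroup.characteristic_iff_comap_eq.1 hchar f] at hx
    exact hx
  have hSF : p ^ 2 ∣ Nat.card F := by
    have h := card_modEq_card_inf_eqLocus hf hfS
    have hdvd : Nat.card ((S : Subgroup A) ⊓ F : Subgroup A) ∣ p ^ 2 :=
      hS ▸ Subgroup.card_dvd_of_le inf_le_left
    have hpdvd : p ∣ Nat.card ((S : Subgroup A) ⊓ F : Subgroup A) := by
      have := Subgroup.card_dvd_of_le (le_inf hKS hKF)
      rwa [hK] at this
    obtain ⟨i, hi, hcard⟩ := (Nat.dvd_prime_pow hp.out).1 hdvd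
    have h' : ((Nat.card S : ℕ) : ZMod q) = (Nat.card ((S : Subgroup A) ⊓ F : Subgroup A) : ℕ) :=
      (ZMod.natCast_eq_natCast_iff _ _ _).2 h
    rw [hS, hcard] at h'
    interval_cases i
    · rw [hcard, pow_zero] at hpdvd
      exact absurd hpdvd hp.out.not_dvd_one
    · push_cast at h'
      rw [hmod] at h'
      norm_num at h'
      exact absurd h'.symm hone
    · exact hcard ▸ Subgroup.card_dvd_of_le inf_le_right
  have hqF : q ∣ Nat.card F := by
    have h := card_modEq_card_inf_eqLocus hf (H := ⊤) (fun _ _ => Subgroup.mem_top _)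
    rw [top_inf_eq, Subgroup.card_top, hA] at h
    exact Nat.modEq_zero_iff_dvd.1 (h.symm.trans (Nat.modEq_zero_iff_dvd.2 (dvd_mul_left _ _)))
  have hFtop : F = ⊤ := by
    apply Subgroup.eq_top_of_le_card
    rw [hA]
    exact Nat.le_of_dvd Nat.card_pos
      ((Nat.Coprime.pow_left 2 ((Nat.coprime_primes hp.out hq.out).2 hpq)).mul_dvd_of_dvd_of_dvd
        hSF hqF)
  ext x
  exact (hFtop ▸ Subgroup.mem_top x : x ∈ F)

theorem IsRegularSubgroup.card_eq {A : Type*} [Group A] {G : Subgroup (Hol A)}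
    (hG : IsRegularSubgroup G) : Nat.card G = Nat.card A :=
  Nat.card_congr (Equiv.ofBijective (fun g : G => holSmul (g : Hol A) 1)
    (Function.bijective_iff_existsUnique _ |>.2 (hG 1)))

/-- The order of a subgroup `G` of the holomorph is the order of its subgroup of translations
times the order of its image in the automorphism group. -/
theorem card_comap_inl_mul_card_map_rightHom {A : Type*} [Group A] (G : Subgroup (Hol A)) :
    Nat.card (G.comap SemidirectProduct.inl) * Nat.card (G.map SemidirectProduct.rightHom) =
      Nat.card G := by
  rw [← Subgroup.card_map_of_injective (K := G.comap SemidirectProduct.inl)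
    (f := (SemidirectProduct.inl : A →* Hol A)) SemidirectProduct.inl_injective, Subgroup.map_comap_eq,
    SemidirectProduct.range_inl_eq_ker_rightHom, ← Subgroup.relIndex_ker,
    ← Subgroup.inf_relIndex_right, ← Subgroup.relIndex_bot_left, ← Subgroup.relIndex_bot_left]
  exact Subgroup.relIndex_mul_relIndex _ _ _ bot_le inf_le_right

/-- For abelian `A`, the translations contained in `G` are stable under the image of `G` in the
automorphism group. -/
theorem right_apply_mem_comap_inl {A : Type*} [CommGroup A] {G : Subgroup (Hol A)} {g : Hol A}
    (hg : g ∈ G) {x : A} (hx : x ∈ G.comap SemidirectProduct.inl) :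
    g.right x ∈ G.comap SemidirectProduct.inl := by
  rw [Subgroup.mem_comap] at hx ⊢
  have h : (SemidirectProduct.inl (g.right x) : Hol A) =
      g * SemidirectProduct.inl x * g⁻¹ := by
    rw [eq_mul_inv_iff_mul_eq]
    ext
    · simp [mul_comm]
    · simp
  rw [h]
  exact G.mul_mem (G.mul_mem hg hx) (G.inv_mem hg)

/-- Let `p, q` be odd primes with `p ≡ -1 (mod q)` and let `A = ℤ/p × ℤ/p × ℤ/q`.
Then there is no regular subgroup `G ≤ Hol(A)` whose image under the projection
`π₂ : Hol(A) → Aut(A)` has order `pq`. -/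
theorem stmt_12 (p q : ℕ) (hp : p.Prime) (hq : q.Prime) (hpodd : Odd p)
    (hqodd : Odd q) (hmod : (p : ZMod q) = -1) :
    ¬ ∃ G : Subgroup (Hol (Multiplicative (ZMod p × ZMod p × ZMod q))),
        IsRegularSubgroup G ∧
        Nat.card (G.map SemidirectProduct.rightHom) = p * q := by
  have : Fact p.Prime := ⟨hp⟩
  have : Fact q.Prime := ⟨hq⟩
  rintro ⟨G, hG, hcard⟩
  have hA : Nat.card (Multiplicative (ZMod p × ZMod p × ZMod q)) = p ^ 2 * q := by
    rw [Nat.card_congr Multiplicative.toAdd, Nat.card_prod, Nat.card_prod, Nat.card_zmod,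
      Nat.card_zmod]
    ring
  have hfin : Finite (Multiplicative (ZMod p × ZMod p × ZMod q)) :=
    Nat.finite_of_card_ne_zero (hA ▸ mul_ne_zero (pow_ne_zero _ hp.ne_zero) hq.ne_zero)
  have hK : Nat.card (G.comap SemidirectProduct.inl) = p := by
    have h := card_comap_inl_mul_card_map_rightHom G
    rw [hcard, hG.card_eq, hA] at h
    refine Nat.eq_of_mul_eq_mul_right (mul_pos hp.pos hq.pos) (h.trans ?_)
    ring
  have : Finite (G.map SemidirectProduct.rightHom) :=
    Nat.finite_of_card_ne_zero (hcard ▸ mul_ne_zero hp.ne_zero hq.ne_zero)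
  obtain ⟨⟨_, g, hg, rfl⟩, hord⟩ := exists_prime_orderOf_dvd_card' q
    (hcard ▸ dvd_mul_left q p : q ∣ Nat.card (G.map SemidirectProduct.rightHom))
  have hgq : orderOf g.right = q := (Subgroup.orderOf_coe _).trans hord
  have hone : g.right = 1 := mulAut_eq_one_of_stabilises hqodd hmod hA
    (orderOf_dvd_iff_pow_eq_one.1 hgq.dvd) hK fun _ => right_apply_mem_comap_inl hg
  rw [hone, orderOf_one] at hgq
  exact hq.one_lt.ne hgq
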